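/- Let m ≥ 4 and let c : ZMod m → ℝ² be an injective map whose image is in general position (no three points collinear). Suppose (plane cycle) that any two closed edges [c i, c (i+1)] and [c j, c (j+1)] of the cycle intersect in at most a common endpoint, and (all diagonals emanate to the inside) that for every i and every j ∉ {i−1, i, i+1} the relation ccw_c(i; i+1, j, i−1) holds. Then the points c 0, …, c (m−1) are in convex position, i.e., for every i the point c i does not lie in the convex hull of the remaining points. -/

import Mathlib

noncomputable def det2 (v w : ℝ × ℝ) : ℝ := v.1 * w.2 - v.2 * w.1

noncomputable def chi {α : Type*} (P : α → ℝ × ℝ) (i j k : α) : ℝ :=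
  Real.sign (det2 (P j - P i) (P k - P i))

def GenPos {α : Type*} (P : α → ℝ × ℝ) : Prop :=
  ∀ i j k : α, i ≠ j → i ≠ k → j ≠ k → chi P i j k ≠ 0

def Ccw {α : Type*} (P : α → ℝ × ℝ) (i j k l : α) : Prop :=
  (chi P i j k = 1 ∧ chi P i k l = 1) ∨
  (chi P i k l = 1 ∧ chi P i l j = 1) ∨
  (chi P i l j = 1 ∧ chi P i j k = 1)

def Admissible {α : Type*} (i j k l : α) : Prop :=
  i ≠ j ∧ i ≠ k ∧ i ≠ l ∧ j ≠ k ∧ j ≠ l ∧ k ≠ l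

def SameRadial {α : Type*} (P Q : α → ℝ × ℝ) : Prop :=
  ∀ i j k l : α, Admissible i j k l → (Ccw P i j k l ↔ Ccw Q i j k l)

def SameUndirected {α : Type*} (P Q : α → ℝ × ℝ) : Prop :=
  ∀ i : α, (∀ j k l : α, Admissible i j k l → (Ccw Q i j k l ↔ Ccw P i j k l)) ∨
           (∀ j k l : α, Admissible i j k l → (Ccw Q i j k l ↔ Ccw P i l k j))

def ExtremeSet {α : Type*} (P : α → ℝ × ℝ) : Set α :=
  {i | P i ∉ convexHull ℝ (P '' {j | j ≠ i})}

def Important {n : ℕ} (P₀ : Fin n → ℝ × ℝ) (H : Set (Fin n)) : Prop :=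
  ∃ Q : Fin n → ℝ × ℝ, Function.Injective Q ∧ GenPos Q ∧ SameRadial P₀ Q ∧ ExtremeSet Q = H

def lineThrough (p q : ℝ × ℝ) : Set (ℝ × ℝ) := {x | ∃ t : ℝ, x = p + t • (q - p)}

/-- Twice the signed area of the triangle `p q r`. -/
noncomputable def area2 (p q r : ℝ × ℝ) : ℝ := det2 (q - p) (r - p)

theorem area2_eq (p q r : ℝ × ℝ) :
    area2 p q r = (q.1 - p.1) * (r.2 - p.2) - (q.2 - p.2) * (r.1 - p.1) := rfl

theorem area2_rotate (p q r : ℝ × ℝ) : area2 q r p = area2 p q r := by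
  simp only [area2_eq]; ring

theorem area2_swap (p q r : ℝ × ℝ) : area2 p r q = -area2 p q r := by
  simp only [area2_eq]; ring

theorem chi_eq_one_iff {α : Type*} (P : α → ℝ × ℝ) (i j k : α) :
    chi P i j k = 1 ↔ 0 < area2 (P i) (P j) (P k) := by
  unfold chi area2
  rcases lt_trichotomy (det2 (P j - P i) (P k - P i)) 0 with h | h | h
  · rw [Real.sign_of_neg h]
    constructor <;> intro _ <;> linarith
  · simp [h]
  · simp [Real.sign_of_pos h, h]

theorem GenPos.area2_ne_zero {α : Type*} {P : α → ℝ × ℝ} (h : GenPos P) {i j k : α}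
    (hij : i ≠ j) (hik : i ≠ k) (hjk : j ≠ k) : area2 (P i) (P j) (P k) ≠ 0 := by
  intro h0
  apply h i j k hij hik hjk
  unfold area2 at h0
  simp [chi, h0]

/-- Two segments whose endpoints strictly separate each other have a common point. -/
theorem exists_mem_segment_inter {t u v w : ℝ × ℝ}
    (ht : 0 < area2 v w t) (hu : area2 v w u < 0)
    (hv : 0 < area2 u t v) (hw : area2 u t w < 0) :
    ∃ x, x ∈ segment ℝ t u ∧ x ∈ segment ℝ v w := by
  have hsum : area2 v w t - area2 v w u = area2 u t v - area2 u t w := by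
    simp only [area2_eq]; ring
  have hpos : 0 < area2 v w t - area2 v w u := by linarith
  set d := area2 v w t - area2 v w u with hd
  refine ⟨(-area2 v w u / d) • t + (area2 v w t / d) • u,
    ⟨_, _, div_nonneg (by linarith) hpos.le, div_nonneg ht.le hpos.le, ?_, rfl⟩,
    ⟨-area2 u t w / d, area2 u t v / d, div_nonneg (by linarith) hpos.le,
      div_nonneg hv.le hpos.le, ?_, ?_⟩⟩
  · rw [← add_div, div_eq_one_iff_eq hpos.ne', hd]; ring
  · rw [← add_div, div_eq_one_iff_eq hpos.ne', hsum]; ring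
  · ext
    all_goals
      simp only [Prod.fst_add, Prod.snd_add, Prod.smul_fst, Prod.smul_snd, smul_eq_mul,
        div_mul_eq_mul_div]
      rw [← add_div, ← add_div]
      congr 1
      simp only [area2_eq]
      ring

/-- A point lying on a line that has all the other points strictly on its left, except for a single
different point on the line, is outside the convex hull of the other points. -/
theorem notMem_convexHull_of_area2_pos {α : Type*} {P : α → ℝ × ℝ} {i j : α} (hij : P i ≠ P j)
    (h : ∀ k, k ≠ i → k ≠ j → 0 < area2 (P i) (P j) (P k)) :
    P i ∉ convexHull ℝ (P '' {k | k ≠ i}) := by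
  let S : Set (ℝ × ℝ) := {x | 0 < area2 (P i) (P j) x ∨ x = P j}
  have hconv : Convex ℝ S := by
    have hcomb (x y : ℝ × ℝ) (a b : ℝ) (hab : a + b = 1) :
        area2 (P i) (P j) (a • x + b • y)
          = a * area2 (P i) (P j) x + b * area2 (P i) (P j) y := by
      obtain rfl : b = 1 - a := by linarith
      simp only [area2_eq, Prod.fst_add, Prod.snd_add, Prod.smul_fst, Prod.smul_snd, smul_eq_mul]
      ring
    have hj : area2 (P i) (P j) (P j) = 0 := by simp only [area2_eq]; ring
    rw [convex_iff_forall_pos]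
    rintro x hx y hy a b ha hb hab
    rcases hx with hx | rfl <;> rcases hy with hy | rfl
    · left; rw [hcomb _ _ _ _ hab]; positivity
    · left; rw [hcomb _ _ _ _ hab, hj]; simpa using mul_pos ha hx
    · left; rw [hcomb _ _ _ _ hab, hj]; simpa using mul_pos hb hy
    · right; rw [← add_smul, hab, one_smul]
  have hsub : P '' {k | k ≠ i} ⊆ S := by
    rintro _ ⟨k, hk, rfl⟩
    by_cases hkj : k = j
    · exact Or.inr (congrArg P hkj)
    · exact Or.inl (h k hk hkj)
  intro hmem
  rcases convexHull_min hsub hconv hmem with h0 | h0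
  · simp [area2_eq] at h0
  · exact hij h0

theorem ccw_iff {α : Type*} (P : α → ℝ × ℝ) (i j k l : α) :
    Ccw P i j k l ↔
      (0 < area2 (P i) (P j) (P k) ∧ 0 < area2 (P i) (P k) (P l)) ∨
      (0 < area2 (P i) (P k) (P l) ∧ 0 < area2 (P i) (P l) (P j)) ∨
      (0 < area2 (P i) (P l) (P j) ∧ 0 < area2 (P i) (P j) (P k)) := by
  simp only [Ccw, chi_eq_one_iff]

theorem ZMod.add_natCast_ne_self {m : ℕ} (i : ZMod m) {k : ℕ} (h0 : 0 < k) (hk : k < m) :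
    i + k ≠ i := by
  rw [Ne, add_eq_left, ZMod.natCast_eq_zero_iff]
  exact Nat.not_dvd_of_pos_of_lt h0 hk

/-- At a left turn, all points lie to the left of the outgoing edge. -/
theorem area2_pos_of_left_turn {m : ℕ} {c : ZMod m → ℝ × ℝ}
    (hinside : ∀ i j : ZMod m, j ≠ i - 1 → j ≠ i → j ≠ i + 1 → Ccw c i (i + 1) j (i - 1))
    {i : ZMod m} (hi : 0 < area2 (c (i - 1)) (c i) (c (i + 1)))
    (k : ZMod m) (hk : k ≠ i) (hk' : k ≠ i + 1) : 0 < area2 (c i) (c (i + 1)) (c k) := by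
  rw [← area2_rotate] at hi
  by_cases hkp : k = i - 1
  · rwa [hkp]
  · have h := (ccw_iff ..).1 (hinside i k hkp hk hk')
    have hs := area2_swap (c i) (c (i + 1)) (c (i - 1))
    rcases h with h | h | h <;> linarith [h.1, h.2]

/-- The cycle has a left turn: two consecutive right turns `u`, `v` whose diagonals avoid their
convex angles would make the edges before `u` and after `v` cross. -/
theorem exists_left_turn {m : ℕ} (hm : 4 ≤ m) {c : ZMod m → ℝ × ℝ}
    (hinj : Function.Injective c) (hgp : GenPos c)
    (hplane : ∀ i j : ZMod m, i ≠ j →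
      ∀ x : ℝ × ℝ, x ∈ segment ℝ (c i) (c (i + 1)) →
        x ∈ segment ℝ (c j) (c (j + 1)) →
        x ∈ ({c i, c (i + 1)} : Set (ℝ × ℝ)) ∩ {c j, c (j + 1)})
    (hinside : ∀ i j : ZMod m, j ≠ i - 1 → j ≠ i → j ≠ i + 1 → Ccw c i (i + 1) j (i - 1)) :
    ∃ i, 0 < area2 (c (i - 1)) (c i) (c (i + 1)) := by
  by_contra! hright
  have key (i : ZMod m) {k : ℕ} (h0 : 0 < k) (hk : k < 4) : i + k ≠ i :=
    ZMod.add_natCast_ne_self i h0 (by omega)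
  obtain ⟨t, u, v, w, htu, huv, hvw, e, e', huv_ne, htv_ne, htw_ne, htu_ne, huw_ne, hvw_ne⟩ :
      ∃ t u v w : ZMod m, t + 1 = u ∧ u + 1 = v ∧ v + 1 = w ∧ u - 1 = t ∧ v - 1 = u ∧
        u ≠ v ∧ t ≠ v ∧ t ≠ w ∧ t ≠ u ∧ u ≠ w ∧ v ≠ w := by
    have h1 : (1 : ZMod m) ≠ 0 := by simpa using key 0 one_pos (by norm_num)
    have h2 : (2 : ZMod m) ≠ 0 := by simpa using key 0 two_pos (by norm_num)
    have h3 : (3 : ZMod m) ≠ 0 := by simpa using key 0 three_pos (by norm_num)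
    refine ⟨0, 1, 2, 3, by ring, by ring, by ring, by ring, by ring,
      fun h => h1 ?_, h2.symm, h3.symm, h1.symm, fun h => h2 ?_, fun h => h1 ?_⟩ <;>
    linear_combination -h
  have turn_u := (hright u).lt_of_ne (hgp.area2_ne_zero
    (by rwa [e]) (by rwa [e, huv]) (by rwa [huv]))
  have in_u := (ccw_iff ..).1 (hinside u w (by rw [e]; exact htw_ne.symm) huw_ne.symm
    (by rw [huv]; exact hvw_ne.symm))
  have in_v := (ccw_iff ..).1 (hinside v t (by rwa [e']) htv_ne (by rwa [hvw]))
  have turn_v := (hright v).lt_of_ne (hgp.area2_ne_zero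
    (by rwa [e']) (by rwa [e', hvw]) (by rwa [hvw]))
  rw [e, huv] at turn_u in_u
  rw [e', hvw] at turn_v in_v
  have rot_tuv := area2_rotate (c t) (c u) (c v)
  have swap_utv := area2_swap (c u) (c t) (c v)
  have rot_uvw := area2_rotate (c u) (c v) (c w)
  have swap_uwt := area2_swap (c u) (c w) (c t)
  have rot_uvt := area2_rotate (c u) (c v) (c t)
  have hw : 0 < area2 (c u) (c w) (c t) := by
    rcases in_u with h | h | h <;> linarith [h.1, h.2]
  have ht : 0 < area2 (c v) (c w) (c t) := by
    rcases in_v with h | h | h <;> linarith [h.1, h.2]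
  obtain ⟨x, hx, hx'⟩ := exists_mem_segment_inter (t := c t) (u := c u) (v := c v) (w := c w)
    ht (by linarith) (by linarith) (by linarith)
  have hmem := hplane t v htv_ne x (by rwa [htu]) (by rwa [hvw])
  rw [htu, hvw] at hmem
  obtain ⟨rfl | rfl, h | h⟩ := hmem
  exacts [htv_ne (hinj h), htw_ne (hinj h), huv_ne (hinj h), huw_ne (hinj h)]

/-- a plane cycle of length at least 4 all of whose diagonals
emanate to the inside (a "compact cycle") has its vertices in convex
position. -/
theorem compact_cycle_convex {m : ℕ} (hm : 4 ≤ m)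
    (c : ZMod m → ℝ × ℝ)
    (hinj : Function.Injective c) (hgp : GenPos c)
    (hplane : ∀ i j : ZMod m, i ≠ j →
      ∀ x : ℝ × ℝ, x ∈ segment ℝ (c i) (c (i + 1)) →
        x ∈ segment ℝ (c j) (c (j + 1)) →
        x ∈ ({c i, c (i + 1)} : Set (ℝ × ℝ)) ∩ {c j, c (j + 1)})
    (hinside : ∀ i j : ZMod m, j ≠ i - 1 → j ≠ i → j ≠ i + 1 →
      Ccw c i (i + 1) j (i - 1)) :
    ∀ i : ZMod m, c i ∉ convexHull ℝ (c '' {j | j ≠ i}) := by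
  have hstep (i : ZMod m) (hi : 0 < area2 (c (i - 1)) (c i) (c (i + 1))) :
      0 < area2 (c (i + 1 - 1)) (c (i + 1)) (c (i + 1 + 1)) := by
    rw [add_sub_cancel_right]
    refine area2_pos_of_left_turn hinside hi _ ?_ ?_
    · simpa [add_assoc, one_add_one_eq_two] using
        ZMod.add_natCast_ne_self i two_pos (by omega : 2 < m)
    · simpa using ZMod.add_natCast_ne_self (i + 1) one_pos (by omega : 1 < m)
  obtain ⟨i₀, hi₀⟩ := exists_left_turn hm hinj hgp hplane hinside
  have hall (n : ℕ) :
      0 < area2 (c (i₀ + n - 1)) (c (i₀ + n)) (c (i₀ + n + 1)) := by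
    induction n with
    | zero => simpa using hi₀
    | succ n ih => simpa [add_assoc] using hstep _ ih
  intro i
  have : NeZero m := ⟨by omega⟩
  obtain ⟨n, hn⟩ := ZMod.natCast_zmod_surjective (i - i₀)
  obtain rfl : i = i₀ + n := by rw [hn]; ring
  refine notMem_convexHull_of_area2_pos (j := i₀ + n + 1) ?_
    (area2_pos_of_left_turn hinside (hall n))
  refine hinj.ne (Ne.symm ?_)
  simpa using ZMod.add_natCast_ne_self (i₀ + (n : ZMod m)) one_pos (by omega : 1 < m)
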